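/- Let b : Ω → ℂ be holomorphic and suppose that the triangular conjugation T_b : x ↦ t(x) x t(x)⁻¹, where t(x) is the lower-triangular matrix with rows (1, 0) and (b(x), 1), is an automorphism of Ω. Then there exist holomorphic functions α, β : ℂ × 𝔾₂ → ℂ such that for all x ∈ Ω: x₁₂ · b(x) = x₁₁ · (1 − exp(x₁₂ · α(x₁₂, tr x, det x))) + x₁₂ · β(x₁₂, tr x, det x). -/

import Mathlib

open Matrix Set

attribute [local instance] Matrix.normedAddCommGroup Matrix.normedSpace

noncomputable section

/-- The algebra of `2 × 2` complex matrices. -/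
abbrev M2 : Type := Matrix (Fin 2) (Fin 2) ℂ

/-- The spectral ball: `2 × 2` complex matrices whose spectral radius is less than `1`. -/
def SpectralBall : Set M2 := {x : M2 | ∀ z ∈ spectrum ℂ x, ‖z‖ < 1}

/-- `f` is an automorphism of the domain `D`. -/
def IsAutomorphismOn {E : Type*} [NormedAddCommGroup E] [NormedSpace ℂ E]
    (D : Set E) (f : E → E) : Prop :=
  DifferentiableOn ℂ f D ∧ MapsTo f D D ∧
    ∃ g : E → E, DifferentiableOn ℂ g D ∧ MapsTo g D D ∧
      (∀ x ∈ D, g (f x) = x) ∧ (∀ x ∈ D, f (g x) = x)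

/-- The lower triangular matrix with rows `(1, 0)` and `(b, 1)`. -/
def TriMat (b : ℂ) : M2 := !![1, 0; b, 1]

/-- The symmetrized bidisc `𝔾₂`. -/
def SymBidisc : Set (ℂ × ℂ) :=
  {p | ∃ z w : ℂ, ‖z‖ < 1 ∧ ‖w‖ < 1 ∧ p = (z + w, z * w)}

/-- A parametric integral of a function holomorphic in the parameter is holomorphic. -/
theorem differentiableAt_intervalIntegral_of_differentiableOn {E : Type*} [NormedAddCommGroup E]
    [NormedSpace ℂ E] [FiniteDimensional ℂ E] {a b : ℝ} {k γ : ℝ → ℂ} (hk : Continuous k)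
    (hγ : Continuous γ) {Φ : ℂ × E → ℂ} {O : Set (ℂ × E)} (hO : IsOpen O)
    (hΦ : DifferentiableOn ℂ Φ O) {x₀ : E} (h : ∀ t ∈ uIcc a b, (γ t, x₀) ∈ O) :
    DifferentiableAt ℂ (fun x => ∫ t in a..b, k t * Φ (γ t, x)) x₀ := by
  have : ProperSpace (ℂ × E) := FiniteDimensional.proper ℂ _
  have : ProperSpace (E →L[ℂ] ℂ) := FiniteDimensional.proper ℂ _
  have : ProperSpace (ℂ × E →L[ℂ] ℂ) := FiniteDimensional.proper ℂ _
  borelize (ℂ × E)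
  borelize (E →L[ℂ] ℂ)
  have hK : IsCompact ((fun t => (γ t, x₀)) '' uIcc a b) :=
    isCompact_uIcc.image (by fun_prop)
  obtain ⟨δ, hδ, hδO⟩ := hK.exists_cthickening_subset_open hO (by
    rintro _ ⟨t, ht, rfl⟩; exact h t ht)
  obtain ⟨M, hM⟩ := (hK.cthickening (r := δ)).exists_bound_of_continuousOn
    (hΦ.continuousOn.mono hδO)
  obtain ⟨N, hN⟩ := isCompact_uIcc.exists_bound_of_continuousOn (s := uIcc a b) hk.continuousOn
  have hmem : ∀ t ∈ uIcc a b, ∀ x ∈ Metric.ball x₀ δ,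
      (γ t, x) ∈ Metric.cthickening δ ((fun t => (γ t, x₀)) '' uIcc a b) := by
    intro t ht x hx
    refine Metric.mem_cthickening_of_dist_le _ (γ t, x₀) _ _ ⟨t, ht, rfl⟩ ?_
    rw [Prod.dist_eq]
    simpa [hδ.le] using (Metric.mem_ball.1 hx).le
  have hdiff : ∀ t ∈ uIcc a b, ∀ x ∈ Metric.ball x₀ δ, DifferentiableAt ℂ Φ (γ t, x) :=
    fun t ht x hx => hΦ.differentiableAt (hO.mem_nhds (hδO (hmem t ht x hx)))
  have hcont : ∀ x ∈ Metric.ball x₀ δ, ContinuousOn (fun t => k t * Φ (γ t, x)) (uIcc a b) := by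
    intro x hx
    refine hk.continuousOn.mul ?_
    intro t ht
    exact ((hdiff t ht x hx).continuousAt.comp (f := fun t => (γ t, x))
      (by fun_prop)).continuousWithinAt
  have key := intervalIntegral.hasFDerivAt_integral_of_dominated_loc_of_lip
    (μ := MeasureTheory.volume) (a := a) (b := b) (𝕜 := ℂ)
    (F := fun x t => k t * Φ (γ t, x))
    (F' := fun t => k t • (fderiv ℂ Φ (γ t, x₀)).comp (ContinuousLinearMap.inr ℂ ℂ E))
    (x₀ := x₀) (s := Metric.ball x₀ (δ / 4)) (bound := fun _ => N * ((M + M) / (δ / 2)))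
    (Metric.ball_mem_nhds _ (by positivity)) ?_ ?_ ?_ ?_ ?_ ?_
  · exact key.2.differentiableAt
  · filter_upwards [Metric.ball_mem_nhds x₀ hδ] with x hx
    exact (intervalIntegrable_iff.1 (hcont x hx).intervalIntegrable).aestronglyMeasurable
  · exact (hcont x₀ (Metric.mem_ball_self hδ)).intervalIntegrable
  · refine Measurable.aestronglyMeasurable ?_
    refine hk.measurable.smul ?_
    have h1 : Measurable fun t => fderiv ℂ Φ (γ t, x₀) :=
      (measurable_fderiv ℂ Φ).comp (by fun_prop : Continuous fun t => (γ t, x₀)).measurable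
    have h2 : Continuous fun L : ℂ × E →L[ℂ] ℂ => L.comp (ContinuousLinearMap.inr ℂ ℂ E) := by
      fun_prop
    exact h2.measurable.comp h1
  · refine Filter.Eventually.of_forall fun t ht => ?_
    have ht' := uIoc_subset_uIcc ht
    have hN0 : 0 ≤ N := (norm_nonneg _).trans (hN t ht')
    refine LipschitzOnWith.of_dist_le_mul fun x hx y hy => ?_
    have hsub : Metric.ball y (δ / 2) ⊆ Metric.ball x₀ δ := by
      refine Metric.ball_subset_ball' ?_
      have := Metric.mem_ball.1 hy
      linarith
    have hyb : y ∈ Metric.ball y (δ / 2) := Metric.mem_ball_self (by positivity)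
    have hxy : x ∈ Metric.ball y (δ / 2) := by
      have h1 := Metric.mem_ball.1 hx
      have h2 := Metric.mem_ball'.1 hy
      have := dist_triangle x x₀ y
      rw [Metric.mem_ball]; linarith
    have hS := Complex.dist_le_div_mul_dist_of_mapsTo_ball (f := fun x => Φ (γ t, x))
      (c := y) (R₁ := δ / 2) (R₂ := M + M) (z := x) ?_ ?_ hxy
    · have hM0 : 0 ≤ M := (norm_nonneg _).trans (hM _ (hmem t ht' y (hsub hyb)))
      rw [Real.coe_nnabs, abs_of_nonneg (by positivity), dist_eq_norm, ← mul_sub, norm_mul,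
        mul_assoc]
      rw [dist_eq_norm] at hS
      exact mul_le_mul (hN t ht') hS (norm_nonneg _) hN0
    · intro z hz
      exact ((hdiff t ht' z (hsub hz)).comp (f := fun x => (γ t, x)) z
        (by fun_prop)).differentiableWithinAt
    · intro z hz
      rw [Metric.mem_closedBall, dist_eq_norm]
      exact (norm_sub_le _ _).trans
        (add_le_add (hM _ (hmem t ht' z (hsub hz))) (hM _ (hmem t ht' y (hsub hyb))))
  · exact intervalIntegrable_const
  · refine Filter.Eventually.of_forall fun t ht => ?_
    have h1 := (hdiff t (uIoc_subset_uIcc ht) x₀ (Metric.mem_ball_self hδ)).hasFDerivAt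
    exact (h1.comp x₀ (hasFDerivAt_prodMk_right (γ t) x₀)).const_mul (k t)

theorem differentiableAt_circleIntegral_of_differentiableOn {E : Type*} [NormedAddCommGroup E]
    [NormedSpace ℂ E] [FiniteDimensional ℂ E] {c : ℂ} {R : ℝ} (hR : 0 ≤ R)
    {Φ : ℂ × E → ℂ} {O : Set (ℂ × E)} (hO : IsOpen O) (hΦ : DifferentiableOn ℂ Φ O) {x₀ : E}
    (h : ∀ w ∈ Metric.sphere c R, (w, x₀) ∈ O) :
    DifferentiableAt ℂ (fun x => ∮ w in C(c, R), Φ (w, x)) x₀ := by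
  simp only [circleIntegral, smul_eq_mul, deriv_circleMap]
  exact differentiableAt_intervalIntegral_of_differentiableOn
    (k := fun θ => circleMap 0 R θ * Complex.I) (by fun_prop) (by fun_prop) hO hΦ
    fun t _ => h _ (circleMap_mem_sphere c hR t)

/-- A left-invertible entire function with entire left inverse is affine. -/
theorem exists_eq_mul_add_of_differentiable_leftInverse {φ ψ : ℂ → ℂ} (hφ : Differentiable ℂ φ)
    (hψ : Differentiable ℂ ψ) (h : Function.LeftInverse ψ φ) :
    ∃ A ≠ 0, ∀ z, φ z = A * z + φ 0 := by
  have hd : deriv φ 0 ≠ 0 := by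
    intro h0
    have h1 : HasDerivAt (fun z => ψ (φ z)) (deriv ψ (φ 0) * deriv φ 0) 0 :=
      (hψ (φ 0)).hasDerivAt.comp 0 (hφ 0).hasDerivAt
    have h2 : (fun z => ψ (φ z)) = id := funext h
    rw [h2, h0, mul_zero] at h1
    exact zero_ne_one (h1.unique (hasDerivAt_id 0))
  have hds : Differentiable ℂ (dslope φ 0) := by
    rw [← differentiableOn_univ]
    exact (Complex.differentiableOn_dslope Filter.univ_mem).2 hφ.differentiableOn
  have hne : ∀ z, dslope φ 0 z ≠ 0 := by
    intro z
    rcases eq_or_ne z 0 with rfl | hz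
    · rwa [dslope_same]
    · rw [dslope_of_ne _ hz, slope_def_field]
      refine div_ne_zero (sub_ne_zero.2 fun h' => hz (h.injective h')) (by simpa using hz)
  set k : ℂ → ℂ := fun z => (dslope φ 0 z)⁻¹ with hk
  have hkd : Differentiable ℂ k := hds.inv hne
  obtain ⟨C, hC0, hC⟩ : ∃ C, 0 ≤ C ∧ ∀ z, ‖k z‖ ≤ C + ‖z‖ := by
    obtain ⟨R, hR⟩ := (isCompact_closedBall (φ 0) 1).exists_bound_of_continuousOn
      hψ.continuous.continuousOn
    obtain ⟨C, hC⟩ := (isCompact_closedBall (0 : ℂ) R).exists_bound_of_continuousOn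
      hkd.continuous.continuousOn
    refine ⟨max C 0, le_max_right _ _, fun z => ?_⟩
    by_cases hz : ‖z‖ ≤ R
    · have := hC z (by simpa using hz)
      have h2 := le_max_left C 0
      have := norm_nonneg z
      linarith
    · have h1 : 1 < ‖φ z - φ 0‖ := by
        by_contra! h1
        exact hz (by simpa [h z] using hR (φ z) (by simpa [dist_eq_norm] using h1))
      have hz0 : z ≠ 0 := by
        rintro rfl
        norm_num at h1
      have h2 : ‖k z‖ ≤ ‖z‖ := by
        rw [hk]
        simp only [dslope_of_ne _ hz0, slope_def_field, inv_div, sub_zero, norm_div]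
        exact div_le_self (norm_nonneg _) h1.le
      exact h2.trans (le_add_of_nonneg_left (le_max_right _ _))
  have hkb : ∀ z, ‖deriv k z‖ ≤ C + 2 := by
    intro z
    have hz1 : 0 < 1 + ‖z‖ := by positivity
    refine (Complex.norm_deriv_le_of_forall_mem_sphere_norm_le hz1 hkd.diffContOnCl
      (C := (C + 2) * (1 + ‖z‖)) fun w hw => ?_).trans_eq (by field_simp)
    refine (hC w).trans ?_
    have h1 : ‖w‖ ≤ ‖w - z‖ + ‖z‖ := by simpa using norm_add_le (w - z) z
    rw [mem_sphere_iff_norm.1 hw] at h1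
    nlinarith [norm_nonneg z]
  obtain ⟨c, hc⟩ := hkd.deriv.exists_const_forall_eq_of_bounded
    (isBounded_iff_forall_norm_le.2 ⟨C + 2, by rintro _ ⟨z, rfl⟩; exact hkb z⟩)
  have hkaff : ∀ z, k z = c * z + k 0 := by
    intro z
    have hd' : Differentiable ℂ fun z => k z - c * z := by fun_prop
    have := is_const_of_deriv_eq_zero hd' (fun w => by
      have := ((hkd w).hasDerivAt.sub ((hasDerivAt_id w).const_mul c)).deriv
      simpa [hc, Pi.sub_def] using this) z 0
    simp only [mul_zero, sub_zero] at this
    linear_combination this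
  have hk0 : ∀ z, k z ≠ 0 := fun z => inv_ne_zero (hne z)
  have hc0 : c = 0 := by
    by_contra hc0
    refine hk0 (-k 0 / c) ?_
    rw [hkaff]; field_simp; ring
  refine ⟨deriv φ 0, hd, fun z => ?_⟩
  have h1 : dslope φ 0 z = dslope φ 0 0 := by
    have := hkaff z
    rw [hc0, zero_mul, zero_add] at this
    exact inv_injective this
  rw [dslope_same] at h1
  have h2 := sub_smul_dslope φ 0 z
  rw [h1] at h2
  simp only [sub_zero, smul_eq_mul] at h2
  linear_combination -h2

/-- A function holomorphic on `{0}ᶜ ×ˢ G`, all of whose slices over a dense subset of `G` have a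
removable singularity at `0`, extends holomorphically to `univ ×ˢ G`. -/
theorem exists_differentiableOn_extension_of_dense {Z : Type*} [NormedAddCommGroup Z]
    [NormedSpace ℂ Z] [FiniteDimensional ℂ Z] {G D : Set Z} (hG : IsOpen G) (hDG : D ⊆ G)
    (hGD : G ⊆ closure D) {f : ℂ × Z → ℂ} (hf : DifferentiableOn ℂ f ({0}ᶜ ×ˢ G))
    (h : ∀ z ∈ D, ∃ g : ℂ → ℂ, Differentiable ℂ g ∧ ∀ u ≠ 0, f (u, z) = g u) :
    ∃ F : ℂ × Z → ℂ, DifferentiableOn ℂ F (univ ×ˢ G) ∧ ∀ u ≠ 0, ∀ z, F (u, z) = f (u, z) := by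
  have hO₀ : IsOpen (({0}ᶜ : Set ℂ) ×ˢ G) := isOpen_compl_singleton.prod hG
  set F₁ : ℂ × Z → ℂ := fun x =>
    (2 * Real.pi * Complex.I)⁻¹ * ∮ w in C(0, 1), (w - x.1)⁻¹ * f (w, x.2) with hF₁
  have hF₁d : ∀ x ∈ Metric.ball (0 : ℂ) 1 ×ˢ G, DifferentiableAt ℂ F₁ x := by
    rintro ⟨u, z⟩ ⟨hu, hz⟩
    refine DifferentiableAt.const_mul ?_ _
    refine differentiableAt_circleIntegral_of_differentiableOn zero_le_one
      (Φ := fun q : ℂ × (ℂ × Z) => (q.1 - q.2.1)⁻¹ * f (q.1, q.2.2))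
      (O := {q | q.1 - q.2.1 ≠ 0} ∩ (fun q => (q.1, q.2.2)) ⁻¹' ({0}ᶜ ×ˢ G)) ?_ ?_ ?_
    · exact (isOpen_ne.preimage (by fun_prop : Continuous fun q : ℂ × (ℂ × Z) => q.1 - q.2.1)).inter
        (hO₀.preimage (by fun_prop))
    · refine DifferentiableOn.mul ?_ ?_
      · exact DifferentiableOn.inv (by fun_prop) fun q hq => hq.1
      · exact hf.comp (f := fun q : ℂ × (ℂ × Z) => (q.1, q.2.2)) (by fun_prop) fun q hq => hq.2
    · intro w hw
      have hw' : ‖w‖ = 1 := by simpa using hw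
      have hu' : ‖u‖ < 1 := by simpa using hu
      refine ⟨fun h0 => ?_, ?_, hz⟩
      · rw [show w = u from sub_eq_zero.1 h0] at hw'
        exact hu'.ne hw'
      · rintro h0
        rw [mem_singleton_iff] at h0
        simp [show w = 0 from h0] at hw'
  have hF₁f : ∀ u ≠ 0, u ∈ Metric.ball (0 : ℂ) 1 → ∀ z ∈ G, F₁ (u, z) = f (u, z) := by
    intro u hu0 hu
    have hD : EqOn (fun z => F₁ (u, z)) (fun z => f (u, z)) D := by
      intro z hz
      obtain ⟨g, hg, hgf⟩ := h z hz
      have hcirc : (∮ w in C(0, 1), (w - u)⁻¹ * f (w, z)) = ∮ w in C(0, 1), (w - u)⁻¹ • g w := by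
        refine circleIntegral.integral_congr zero_le_one fun w hw => ?_
        have hw0 : w ≠ 0 := by
          rintro rfl
          simp at hw
        simp [hgf w hw0]
      have := hg.diffContOnCl.two_pi_i_inv_smul_circleIntegral_sub_inv_smul hu
      simp only [hF₁, hcirc, hgf u hu0, ← this, smul_eq_mul]
    refine hD.of_subset_closure ?_ ?_ hDG hGD
    · intro z hz
      exact ((hF₁d (u, z) ⟨hu, hz⟩).continuousAt.comp (f := fun z => (u, z))
        (by fun_prop)).continuousWithinAt
    · exact hf.continuousOn.comp (by fun_prop) fun z hz => ⟨hu0, hz⟩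
  classical
  refine ⟨fun x => if x.1 = 0 then F₁ x else f x, ?_, fun u hu z => by simp [hu]⟩
  rintro ⟨u, z⟩ ⟨-, hz⟩
  refine DifferentiableAt.differentiableWithinAt ?_
  rcases eq_or_ne u 0 with rfl | hu
  · have h0 : (0 : ℂ) ∈ Metric.ball (0 : ℂ) 1 := by simp
    refine (hF₁d (0, z) ⟨h0, hz⟩).congr_of_eventuallyEq ?_
    filter_upwards [(Metric.isOpen_ball.prod hG).mem_nhds (mk_mem_prod h0 hz)]
    rintro ⟨v, y⟩ ⟨hv, hy⟩
    by_cases hv0 : v = 0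
    · simp [hv0]
    · simp [hv0, hF₁f v hv0 hv y hy]
  · have hmem : (u, z) ∈ ({0}ᶜ : Set ℂ) ×ˢ G := ⟨hu, hz⟩
    refine (hf.differentiableAt (hO₀.mem_nhds hmem)).congr_of_eventuallyEq ?_
    filter_upwards [hO₀.mem_nhds hmem]
    rintro ⟨v, y⟩ ⟨hv, hy⟩
    simp [show v ≠ 0 from hv]

/-- The partial derivative of a holomorphic function in the first variable is holomorphic. -/
theorem differentiableOn_deriv_fst {Z : Type*} [NormedAddCommGroup Z]
    [NormedSpace ℂ Z] [FiniteDimensional ℂ Z] {G : Set Z} (hG : IsOpen G) {A : ℂ × Z → ℂ}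
    (hA : DifferentiableOn ℂ A (univ ×ˢ G)) :
    DifferentiableOn ℂ (fun x : ℂ × Z => deriv (fun v => A (v, x.2)) x.1) (univ ×ˢ G) := by
  have hslice : ∀ u, ∀ z ∈ G, (2 * Real.pi * Complex.I)⁻¹ *
      (∮ w in C(0, 1), (w ^ 2)⁻¹ * A (u + w, z)) = deriv (fun v => A (v, z)) u := by
    intro u z hz
    have hd : Differentiable ℂ fun w => A (u + w, z) := by
      rw [← differentiableOn_univ]
      exact hA.comp (by fun_prop) fun w _ => ⟨mem_univ _, hz⟩
    have := hd.differentiableOn.deriv_eq_smul_circleIntegral (c := 0) (R := 1) one_pos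
    rw [deriv_comp_const_add (fun v => A (v, z)) u 0] at this
    simp only [sub_zero, one_div, smul_eq_mul, add_zero] at this
    rw [this, inv_mul_cancel_left₀ Complex.two_pi_I_ne_zero]
  refine DifferentiableOn.congr (f := fun x : ℂ × Z => (2 * Real.pi * Complex.I)⁻¹ *
      (∮ w in C(0, 1), (w ^ 2)⁻¹ * A (x.1 + w, x.2))) ?_ fun x hx => (hslice _ _ hx.2).symm
  rintro ⟨u, z⟩ ⟨-, hz⟩
  refine (DifferentiableAt.const_mul ?_ _).differentiableWithinAt
  refine differentiableAt_circleIntegral_of_differentiableOn zero_le_one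
    (Φ := fun q : ℂ × (ℂ × Z) => (q.1 ^ 2)⁻¹ * A (q.2.1 + q.1, q.2.2))
    (O := {0}ᶜ ×ˢ (univ ×ˢ G)) (isOpen_compl_singleton.prod (isOpen_univ.prod hG)) ?_ ?_
  · refine DifferentiableOn.mul ?_ ?_
    · exact DifferentiableOn.inv (by fun_prop) fun q hq => pow_ne_zero 2 hq.1
    · exact hA.comp (f := fun q : ℂ × (ℂ × Z) => (q.2.1 + q.1, q.2.2)) (by fun_prop)
        fun q hq => ⟨mem_univ _, hq.2.2⟩
  · intro w hw
    refine ⟨?_, mem_univ _, hz⟩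
    rintro h0
    simp [show w = 0 from h0] at hw

/-- A nonvanishing holomorphic function on `ℂ × G` that equals `1` on `{0} × G` is the exponential
of a holomorphic function divisible by the first coordinate. -/
theorem exists_eq_exp_fst_mul {Z : Type*} [NormedAddCommGroup Z]
    [NormedSpace ℂ Z] [FiniteDimensional ℂ Z] {G : Set Z} (hG : IsOpen G) {A : ℂ × Z → ℂ}
    (hA : DifferentiableOn ℂ A (univ ×ˢ G)) (hne : ∀ u, ∀ z ∈ G, A (u, z) ≠ 0)
    (h1 : ∀ z ∈ G, A (0, z) = 1) :
    ∃ α : ℂ × Z → ℂ, DifferentiableOn ℂ α (univ ×ˢ G) ∧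
      ∀ u, ∀ z ∈ G, A (u, z) = Complex.exp (u * α (u, z)) := by
  set Q : ℂ × Z → ℂ := fun x => deriv (fun v => A (v, x.2)) x.1 * (A x)⁻¹ with hQ
  have hQd : DifferentiableOn ℂ Q (univ ×ˢ G) :=
    (differentiableOn_deriv_fst hG hA).mul (hA.inv fun x hx => hne x.1 x.2 hx.2)
  refine ⟨fun x => ∫ t in (0 : ℝ)..1, 1 * Q (t * x.1, x.2), ?_, fun u z hz => ?_⟩
  · rintro ⟨u, z⟩ ⟨-, hz⟩
    refine (differentiableAt_intervalIntegral_of_differentiableOn (k := fun _ => 1)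
      (γ := fun t : ℝ => (t : ℂ))
      (Φ := fun q : ℂ × (ℂ × Z) => Q (q.1 * q.2.1, q.2.2)) (O := univ ×ˢ (univ ×ˢ G))
      (by fun_prop) (by fun_prop) (isOpen_univ.prod (isOpen_univ.prod hG))
      ?_ fun t _ => ⟨mem_univ _, mem_univ _, hz⟩).differentiableWithinAt
    exact hQd.comp (f := fun q : ℂ × (ℂ × Z) => (q.1 * q.2.1, q.2.2)) (by fun_prop)
        fun q hq => ⟨mem_univ _, hq.2.2⟩
  · have hAs : Differentiable ℂ fun v => A (v, z) := by
      rw [← differentiableOn_univ]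
      exact hA.comp (by fun_prop) fun w _ => ⟨mem_univ _, hz⟩
    have hQs : Continuous fun v => Q (v, z) := by
      rw [← continuousOn_univ]
      exact hQd.continuousOn.comp (by fun_prop) fun w _ => ⟨mem_univ _, hz⟩
    have hAt : ∀ t : ℝ, HasDerivAt (fun t : ℝ => A (t * u, z))
        (A (t * u, z) * (u * Q (t * u, z))) t := by
      intro t
      have hl : HasDerivAt (fun s : ℂ => s * u) u (t : ℂ) := by
        simpa using (hasDerivAt_id (t : ℂ)).mul_const u
      refine ((hAs (t * u)).hasDerivAt.comp (t : ℂ) hl).comp_ofReal.congr_deriv ?_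
      rw [hQ]
      field_simp [hne (t * u) z hz]
    have hIt : ∀ t : ℝ, HasDerivAt (fun t : ℝ => ∫ s in (0 : ℝ)..t, Q (s * u, z))
        (Q (t * u, z)) t := by
      intro t
      have hc : Continuous fun s : ℝ => Q (s * u, z) :=
        hQs.comp (by fun_prop : Continuous fun s : ℝ => (s : ℂ) * u)
      exact intervalIntegral.integral_hasDerivAt_right (hc.intervalIntegrable _ _)
        (hc.stronglyMeasurableAtFilter _ _) hc.continuousAt
    have hconst := fun t : ℝ => ((hAt t).mul ((hIt t).const_mul (-u)).cexp)
    have := is_const_of_deriv_eq_zero (fun t => (hconst t).differentiableAt)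
      (fun t => (hconst t).deriv.trans (by ring)) 1 0
    simp only [Pi.mul_apply, Complex.ofReal_one, one_mul, Complex.ofReal_zero, zero_mul, h1 z hz,
      intervalIntegral.integral_same, mul_zero, Complex.exp_zero, neg_mul,
      Complex.exp_neg, inv_one] at this ⊢
    exact (mul_inv_eq_one₀ (Complex.exp_ne_zero _)).1 this

theorem exists_add_eq_mul_eq (s p : ℂ) : ∃ z w : ℂ, z + w = s ∧ z * w = p := by
  obtain ⟨d, hd⟩ := IsAlgClosed.exists_pow_nat_eq (s ^ 2 - 4 * p) two_pos
  exact ⟨(s + d) / 2, (s - d) / 2, by ring, by linear_combination -hd / 4⟩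

theorem mem_symBidisc_iff {s p : ℂ} :
    (s, p) ∈ SymBidisc ↔ ∀ μ : ℂ, μ ^ 2 - s * μ + p = 0 → ‖μ‖ < 1 := by
  constructor
  · rintro ⟨z, w, hz, hw, h⟩ μ hμ
    obtain ⟨rfl, rfl⟩ := Prod.mk.inj h
    have h0 : (μ - z) * (μ - w) = 0 := by linear_combination hμ
    rcases mul_eq_zero.1 h0 with h0 | h0
    · rwa [sub_eq_zero.1 h0]
    · rwa [sub_eq_zero.1 h0]
  · intro h
    obtain ⟨z, w, rfl, rfl⟩ := exists_add_eq_mul_eq s p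
    exact ⟨z, w, h z (by ring), h w (by ring), rfl⟩

theorem mem_spectralBall_iff {x : M2} : x ∈ SpectralBall ↔ (x.trace, x.det) ∈ SymBidisc := by
  rw [mem_symBidisc_iff]
  refine forall_congr' fun μ => ?_
  rw [Matrix.mem_spectrum_iff_isRoot_charpoly, Matrix.charpoly_fin_two]
  simp [Polynomial.IsRoot]

theorem isOpen_symBidisc : IsOpen SymBidisc := by
  rw [Metric.isOpen_iff]
  rintro _ ⟨z, w, hz, hw, rfl⟩
  have hm : 0 < (1 - ‖z‖) * (1 - ‖w‖) := mul_pos (by linarith) (by linarith)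
  refine ⟨(1 - ‖z‖) * (1 - ‖w‖) / 2, by positivity, ?_⟩
  rintro ⟨s, p⟩ hsp
  rw [mem_symBidisc_iff]
  intro μ hμ
  by_contra! h1
  rw [Metric.mem_ball, Prod.dist_eq, max_lt_iff, dist_eq_norm, dist_eq_norm] at hsp
  have hs : ‖s - (z + w)‖ < (1 - ‖z‖) * (1 - ‖w‖) / 2 := hsp.1
  have hp : ‖p - z * w‖ < (1 - ‖z‖) * (1 - ‖w‖) / 2 := hsp.2
  have hfac : (μ - z) * (μ - w) = (s - (z + w)) * μ - (p - z * w) := by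
    linear_combination hμ
  have hup : ‖(μ - z) * (μ - w)‖ < (1 - ‖z‖) * (1 - ‖w‖) * ‖μ‖ := by
    rw [hfac]
    refine (norm_sub_le _ _).trans_lt ?_
    rw [norm_mul]
    nlinarith
  have hz' : ‖μ‖ * (1 - ‖z‖) ≤ ‖μ - z‖ := by
    have := norm_sub_norm_le μ z
    nlinarith [norm_nonneg z]
  have hw' : ‖μ‖ * (1 - ‖w‖) ≤ ‖μ - w‖ := by
    have := norm_sub_norm_le μ w
    nlinarith [norm_nonneg w]
  have hlow : ‖μ‖ * (1 - ‖z‖) * (‖μ‖ * (1 - ‖w‖)) ≤ ‖(μ - z) * (μ - w)‖ := by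
    rw [norm_mul]
    exact mul_le_mul hz' hw' (mul_nonneg (norm_nonneg _) (by linarith)) (norm_nonneg _)
  nlinarith [mul_pos hm (by linarith : 0 < ‖μ‖)]

/-- The points of the symmetrized bidisc off the discriminant locus. -/
def SymBidiscDistinct : Set (ℂ × ℂ) :=
  {p | ∃ z w : ℂ, ‖z‖ < 1 ∧ ‖w‖ < 1 ∧ z ≠ w ∧ p = (z + w, z * w)}

theorem symBidiscDistinct_subset : SymBidiscDistinct ⊆ SymBidisc := by
  rintro _ ⟨z, w, hz, hw, -, rfl⟩
  exact ⟨z, w, hz, hw, rfl⟩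

theorem symBidisc_subset_closure : SymBidisc ⊆ closure SymBidiscDistinct := by
  rintro _ ⟨z, w, hz, hw, rfl⟩
  have ht : Filter.Tendsto (fun t : ℂ => (z + t, z * t)) (nhdsWithin w {w}ᶜ)
      (nhds (z + w, z * w)) :=
    ((by fun_prop : Continuous fun t : ℂ => (z + t, z * t)).tendsto w).mono_left
      nhdsWithin_le_nhds
  by_cases hzw : z = w
  · refine mem_closure_of_tendsto ht ?_
    filter_upwards [self_mem_nhdsWithin, nhdsWithin_le_nhds
      ((isOpen_lt continuous_norm continuous_const).mem_nhds (x := w) hw)] with t ht0 ht1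
    exact ⟨z, t, hz, ht1, fun h => ht0 (h ▸ hzw), rfl⟩
  · exact subset_closure ⟨z, w, hz, hw, hzw, rfl⟩

/-- The matrix with entries `x₁₁ = a`, `x₁₂ = u`, trace `s` and (for `u ≠ 0`) determinant `p`. -/
def fiberMatrix (u s p a : ℂ) : M2 := !![a, u; (a * (s - a) - p) / u, s - a]

theorem trace_fiberMatrix (u s p a : ℂ) : (fiberMatrix u s p a).trace = s := by
  simp [fiberMatrix, Matrix.trace_fin_two]

theorem det_fiberMatrix {u : ℂ} (hu : u ≠ 0) (s p a : ℂ) : (fiberMatrix u s p a).det = p := by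
  simp only [fiberMatrix, Matrix.det_fin_two_of]
  field_simp
  ring

theorem eq_fiberMatrix {x : M2} (hu : x 0 1 ≠ 0) :
    x = fiberMatrix (x 0 1) x.trace x.det (x 0 0) := by
  ext i j
  fin_cases i <;> fin_cases j <;> simp [fiberMatrix, Matrix.trace_fin_two, Matrix.det_fin_two]
  field_simp

theorem fiberMatrix_mem {u s p : ℂ} (hu : u ≠ 0) (h : (s, p) ∈ SymBidisc) (a : ℂ) :
    fiberMatrix u s p a ∈ SpectralBall := by
  rwa [mem_spectralBall_iff, trace_fiberMatrix, det_fiberMatrix hu]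

theorem fiberMatrix_add_mul (u z w : ℂ) :
    fiberMatrix u (z + w) (z * w) z = !![z, u; 0, w] := by
  ext i j
  fin_cases i <;> fin_cases j <;> simp [fiberMatrix]

theorem inv_triMat (c : ℂ) : (TriMat c)⁻¹ = TriMat (-c) := by
  refine Matrix.inv_eq_right_inv ?_
  ext i j
  fin_cases i <;> fin_cases j <;> simp [TriMat, Matrix.mul_apply]

theorem triMat_conj_apply_zero_zero (c : ℂ) (x : M2) :
    (TriMat c * x * (TriMat c)⁻¹) 0 0 = x 0 0 - x 0 1 * c := by
  rw [inv_triMat]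
  simp [TriMat, Matrix.mul_apply, Fin.sum_univ_two, sub_eq_add_neg, Matrix.vecMul, dotProduct]

theorem triMat_conj_apply_zero_one (c : ℂ) (x : M2) :
    (TriMat c * x * (TriMat c)⁻¹) 0 1 = x 0 1 := by
  rw [inv_triMat]
  simp [TriMat, Matrix.mul_apply, Fin.sum_univ_two, Matrix.vecMul, dotProduct]

theorem inv_triMat_mul_triMat (c : ℂ) : (TriMat c)⁻¹ * TriMat c = 1 :=
  Matrix.nonsing_inv_mul _ (by simp [TriMat])

theorem trace_triMat_conj (c : ℂ) (x : M2) :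
    (TriMat c * x * (TriMat c)⁻¹).trace = x.trace := by
  rw [Matrix.trace_mul_comm, ← mul_assoc, inv_triMat_mul_triMat, one_mul]

theorem det_triMat_conj (c : ℂ) (x : M2) :
    (TriMat c * x * (TriMat c)⁻¹).det = x.det := by
  rw [Matrix.det_mul_comm, ← mul_assoc, inv_triMat_mul_triMat, one_mul]

theorem DifferentiableOn.matrix_of {E : Type*} [NormedAddCommGroup E] [NormedSpace ℂ E]
    {S : Set E} {f : E → M2} (h : ∀ i j, DifferentiableOn ℂ (fun x => f x i j) S) :
    DifferentiableOn ℂ f S :=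
  differentiableOn_pi.2 fun i => differentiableOn_pi.2 fun j => h i j

theorem DifferentiableOn.matrix_apply {E : Type*} [NormedAddCommGroup E] [NormedSpace ℂ E]
    {S : Set E} {f : E → M2} (h : DifferentiableOn ℂ f S) (i j : Fin 2) :
    DifferentiableOn ℂ (fun x => f x i j) S :=
  differentiableOn_pi.1 (differentiableOn_pi.1 h i) j

theorem differentiableOn_fiberMatrix {E : Type*} [NormedAddCommGroup E] [NormedSpace ℂ E]
    {S : Set E} {u s p a : E → ℂ} (hu : DifferentiableOn ℂ u S) (hs : DifferentiableOn ℂ s S)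
    (hp : DifferentiableOn ℂ p S) (ha : DifferentiableOn ℂ a S) (h0 : ∀ x ∈ S, u x ≠ 0) :
    DifferentiableOn ℂ (fun x => fiberMatrix (u x) (s x) (p x) (a x)) S := by
  refine DifferentiableOn.matrix_of fun i j => ?_
  fin_cases i <;> fin_cases j
  · exact ha
  · exact hu
  · exact (((ha.mul (hs.sub ha)).sub hp).mul (hu.inv h0)).congr fun _ _ => div_eq_mul_inv _ _
  · exact hs.sub ha

/-- On each fibre of `x ↦ (x₁₂, tr x, det x)` over `u ≠ 0`, a triangular conjugation that is an
automorphism acts as an affine automorphism of the `x₁₁`-line. -/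
theorem exists_affine_of_isAutomorphismOn {b : M2 → ℂ}
    (haut : IsAutomorphismOn SpectralBall (fun x => TriMat (b x) * x * (TriMat (b x))⁻¹))
    {u s p : ℂ} (hu : u ≠ 0) (hsp : (s, p) ∈ SymBidisc) :
    ∃ A ≠ 0, ∀ a, a - u * b (fiberMatrix u s p a) = A * a - u * b (fiberMatrix u s p 0) := by
  obtain ⟨hf, hfm, g, hg, hgm, hgf, hfg⟩ := haut
  set f : M2 → M2 := fun x => TriMat (b x) * x * (TriMat (b x))⁻¹ with hf_def
  have hmem := fiberMatrix_mem hu hsp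
  have hfib : DifferentiableOn ℂ (fun a : ℂ => fiberMatrix u s p a) univ :=
    differentiableOn_fiberMatrix (by fun_prop) (by fun_prop) (by fun_prop) (by fun_prop)
      fun _ _ => hu
  have h00 : ∀ a, f (fiberMatrix u s p a) 0 0 = a - u * b (fiberMatrix u s p a) := fun a =>
    triMat_conj_apply_zero_zero _ _
  have hf_eq : ∀ a, f (fiberMatrix u s p a) =
      fiberMatrix u s p (f (fiberMatrix u s p a) 0 0) := by
    intro a
    have h01 : f (fiberMatrix u s p a) 0 1 = u := triMat_conj_apply_zero_one _ _
    have := eq_fiberMatrix (x := f (fiberMatrix u s p a)) (by rwa [h01])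
    rwa [h01, hf_def, trace_triMat_conj, det_triMat_conj, trace_fiberMatrix,
      det_fiberMatrix hu] at this
  have hφ : Differentiable ℂ fun a => f (fiberMatrix u s p a) 0 0 := by
    rw [← differentiableOn_univ]
    exact (hf.comp hfib fun a _ => hmem a).matrix_apply 0 0
  have hψ : Differentiable ℂ fun a => g (fiberMatrix u s p a) 0 0 := by
    rw [← differentiableOn_univ]
    exact (hg.comp hfib fun a _ => hmem a).matrix_apply 0 0
  obtain ⟨A, hA, h⟩ := exists_eq_mul_add_of_differentiable_leftInverse hφ hψ fun a => by
    rw [← hf_eq, hgf _ (hmem a)]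
    rfl
  refine ⟨A, hA, fun a => ?_⟩
  rw [← h00, h a, h00]
  ring

/-- If the triangular conjugation `T_b` is an automorphism of the spectral ball, then
`b` has the form
`x₁₂ b(x) = x₁₁ (1 − exp(x₁₂ α(x₁₂, tr x, det x))) + x₁₂ β(x₁₂, tr x, det x)`
for some holomorphic `α, β : ℂ × 𝔾₂ → ℂ`. -/
theorem triangular_conjugation_coefficient_form
    (b : M2 → ℂ) (hb : DifferentiableOn ℂ b SpectralBall)
    (haut : IsAutomorphismOn SpectralBall
      (fun x => TriMat (b x) * x * (TriMat (b x))⁻¹)) :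
    ∃ α β : ℂ × ℂ × ℂ → ℂ,
      DifferentiableOn ℂ α (Set.univ ×ˢ SymBidisc) ∧
      DifferentiableOn ℂ β (Set.univ ×ˢ SymBidisc) ∧
      ∀ x ∈ SpectralBall,
        x 0 1 * b x =
          x 0 0 * (1 - Complex.exp (x 0 1 * α (x 0 1, x.trace, x.det)))
            + x 0 1 * β (x 0 1, x.trace, x.det) := by
  have hrel : ∀ u ≠ 0, ∀ s p, (s, p) ∈ SymBidisc →
      1 - u * (b (fiberMatrix u s p 1) - b (fiberMatrix u s p 0)) ≠ 0 ∧
      ∀ a, b (fiberMatrix u s p a) =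
        a * (b (fiberMatrix u s p 1) - b (fiberMatrix u s p 0)) + b (fiberMatrix u s p 0) := by
    intro u hu s p hsp
    obtain ⟨A, hA, h⟩ := exists_affine_of_isAutomorphismOn haut hu hsp
    have h1 := h 1
    refine ⟨fun h0 => hA (by linear_combination h0 - h1), fun a => mul_left_cancel₀ hu ?_⟩
    linear_combination a * h1 - h a
  have hd : ∀ a, DifferentiableOn ℂ
      (fun x : ℂ × ℂ × ℂ => b (fiberMatrix x.1 x.2.1 x.2.2 a)) ({0}ᶜ ×ˢ SymBidisc) := by
    intro a
    refine hb.comp (differentiableOn_fiberMatrix (by fun_prop) (by fun_prop) (by fun_prop)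
      (by fun_prop) fun x hx => hx.1) fun x hx => fiberMatrix_mem hx.1 hx.2 a
  have htri : ∀ z w : ℂ, ‖z‖ < 1 → ‖w‖ < 1 →
      Differentiable ℂ fun u : ℂ => b !![z, u; 0, w] := by
    intro z w hz hw
    rw [← differentiableOn_univ]
    refine hb.comp (DifferentiableOn.matrix_of fun i j => ?_) fun u _ => ?_
    · fin_cases i <;> fin_cases j <;> (simp; try fun_prop)
    · rw [mem_spectralBall_iff]
      exact ⟨z, w, hz, hw, by simp [Matrix.trace_fin_two, Matrix.det_fin_two]⟩
  have hE : ∀ z w : ℂ, ‖z‖ < 1 → ‖w‖ < 1 → z ≠ w → ∀ u ≠ 0,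
      b (fiberMatrix u (z + w) (z * w) 1) - b (fiberMatrix u (z + w) (z * w) 0) =
        (b !![z, u; 0, w] - b !![w, u; 0, z]) / (z - w) := by
    intro z w hz hw hzw u hu
    have h := (hrel u hu (z + w) (z * w) ⟨z, w, hz, hw, rfl⟩).2
    rw [eq_div_iff (sub_ne_zero.2 hzw), ← fiberMatrix_add_mul u z w, ← fiberMatrix_add_mul u w z,
      add_comm w z, mul_comm w z, h z, h w]
    ring
  obtain ⟨E, hEd, hEeq⟩ := exists_differentiableOn_extension_of_dense isOpen_symBidisc
    symBidiscDistinct_subset symBidisc_subset_closure ((hd 1).sub (hd 0)) (by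
      rintro _ ⟨z, w, hz, hw, hzw, rfl⟩
      exact ⟨_, ((htri z w hz hw).sub (htri w z hw hz)).div_const (z - w), hE z w hz hw hzw⟩)
  obtain ⟨β, hβd, hβeq⟩ := exists_differentiableOn_extension_of_dense isOpen_symBidisc
    symBidiscDistinct_subset symBidisc_subset_closure (hd 0) (by
      rintro _ ⟨z, w, hz, hw, hzw, rfl⟩
      refine ⟨_, (htri z w hz hw).sub
        ((((htri z w hz hw).sub (htri w z hw hz)).div_const (z - w)).const_mul z), ?_⟩
      intro u hu
      have h := (hrel u hu (z + w) (z * w) ⟨z, w, hz, hw, rfl⟩).2 z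
      rw [hE z w hz hw hzw u hu, fiberMatrix_add_mul] at h
      simp only [Pi.sub_apply]
      linear_combination -h)
  simp only [Pi.sub_apply] at hEeq
  obtain ⟨α, hαd, hα⟩ := exists_eq_exp_fst_mul isOpen_symBidisc
    (A := fun x : ℂ × ℂ × ℂ => 1 - x.1 * E x) (by fun_prop) (by
      rintro u ⟨s, p⟩ hsp
      rcases eq_or_ne u 0 with rfl | hu
      · simp
      · simpa only [hEeq u hu] using (hrel u hu s p hsp).1) (by simp)
  refine ⟨α, β, hαd, hβd, fun x hx => ?_⟩
  have hx' := mem_spectralBall_iff.1 hx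
  rw [← hα _ _ hx']
  rcases eq_or_ne (x 0 1) 0 with hu | hu
  · simp [hu]
  · have h := (hrel _ hu _ _ hx').2 (x 0 0)
    rw [← eq_fiberMatrix hu] at h
    rw [hβeq _ hu, hEeq _ hu]
    linear_combination x 0 1 * h
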